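/- The range of the map φ₀ : L × ℤ → J₃ is exactly the subgroup H of J₃ generated by s₁₂ and s₂₃; in particular every element of H equals φ₀(a, k) for some label a ∈ L and integer k. -/

import Mathlib

/-- Generators of the cactus group `J₃`. -/
inductive CactusGen : Type
  | s12 | s23 | s13
  deriving DecidableEq

open FreeGroup in
/-- Relators of the cactus group `J₃`:
`s₁₂² = s₂₃² = s₁₃² = 1`, `s₁₂·s₁₃ = s₁₃·s₂₃`, `s₂₃·s₁₃ = s₁₃·s₁₂`. -/
def cactusRels : Set (FreeGroup CactusGen) :=
  { of .s12 * of .s12,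
    of .s23 * of .s23,
    of .s13 * of .s13,
    of .s12 * of .s13 * (of .s13 * of .s23)⁻¹,
    of .s23 * of .s13 * (of .s13 * of .s12)⁻¹ }

/-- The cactus group `J₃` as a presented group. -/
abbrev J3 : Type := PresentedGroup cactusRels

def s12 : J3 := PresentedGroup.of .s12
def s23 : J3 := PresentedGroup.of .s23
def s13 : J3 := PresentedGroup.of .s13

/-- The subgroup `H = J₃^{2}` of `J₃` generated by `s₁₂` and `s₂₃`. -/
def H : Subgroup J3 := Subgroup.closure {s12, s23}

/-- The three labels `[213]`, `[123]`, `[132]`. -/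
inductive L : Type
  | v213 | v123 | v132
  deriving DecidableEq

/-- The map `φ₀ : L × ℤ → J₃`. -/
def phi0 : L × ℤ → J3
  | (.v213, k) =>
      if k % 2 = 0 then (s12 * s23) ^ ((3 * k) / 2) * s12 else (s12 * s23) ^ ((3 * k + 1) / 2)
  | (.v123, k) =>
      if k % 2 = 0 then (s12 * s23) ^ ((3 * k) / 2) else (s12 * s23) ^ ((3 * k - 1) / 2) * s12
  | (.v132, k) =>
      if k % 2 = 0 then (s12 * s23) ^ ((3 * k - 2) / 2) * s12 else (s12 * s23) ^ ((3 * k - 1) / 2)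

theorem s12_mul_self : s12 * s12 = 1 :=
  PresentedGroup.one_of_mem (rels := cactusRels)
    (x := FreeGroup.of .s12 * FreeGroup.of .s12) (by simp [cactusRels])

theorem s23_mul_self : s23 * s23 = 1 :=
  PresentedGroup.one_of_mem (rels := cactusRels)
    (x := FreeGroup.of .s23 * FreeGroup.of .s23) (by simp [cactusRels])

/-- In a group, every element of the subgroup generated by two involutions `a`, `b` is a power of
`a * b` or such a power times `a`. -/
theorem exists_zpow_of_mem_closure_pair {G : Type*} [Group G] {a b x : G}
    (ha : a * a = 1) (hb : b * b = 1) (hx : x ∈ Subgroup.closure {a, b}) :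
    ∃ n : ℤ, x = (a * b) ^ n ∨ x = (a * b) ^ n * a := by
  have ha' : a⁻¹ = a := inv_eq_of_mul_eq_one_left ha
  have hb' : b⁻¹ = b := inv_eq_of_mul_eq_one_left hb
  have step (x y : G) (hy : y ∈ ({a, b} : Set G))
      (h : ∃ n : ℤ, x = (a * b) ^ n ∨ x = (a * b) ^ n * a) :
      ∃ n : ℤ, x * y = (a * b) ^ n ∨ x * y = (a * b) ^ n * a := by
    obtain ⟨n, rfl | rfl⟩ := h <;> obtain rfl | rfl := hy
    · exact ⟨n, .inr rfl⟩
    · exact ⟨n - 1, .inr (by rw [zpow_sub_one, mul_inv_rev, ha', hb', mul_assoc, mul_assoc, ha,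
        mul_one])⟩
    · exact ⟨n, .inl (by rw [mul_assoc, ha, mul_one])⟩
    · exact ⟨n + 1, .inl (by rw [zpow_add_one, mul_assoc])⟩
  induction hx using Subgroup.closure_induction_right with
  | one => exact ⟨0, .inl (zpow_zero _).symm⟩
  | mul_right x _ y hy ih => exact step x y hy ih
  | mul_inv_cancel x _ y hy ih =>
    have hy' : y⁻¹ = y := by obtain rfl | rfl := hy <;> assumption
    exact hy'.symm ▸ step x y hy ih

theorem zpow_mem_range_phi0 (n : ℤ) : (s12 * s23) ^ n ∈ Set.range phi0 := by
  obtain ⟨m, rfl | rfl | rfl⟩ : ∃ m, n = 3 * m ∨ n = 3 * m + 1 ∨ n = 3 * m + 2 :=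
    ⟨n / 3, by omega⟩
  · refine ⟨(.v123, 2 * m), ?_⟩
    rw [phi0, if_pos (by omega)]
    congr 1; omega
  · refine ⟨(.v132, 2 * m + 1), ?_⟩
    rw [phi0, if_neg (by omega)]
    congr 1; omega
  · refine ⟨(.v213, 2 * m + 1), ?_⟩
    rw [phi0, if_neg (by omega)]
    congr 1; omega

theorem zpow_mul_s12_mem_range_phi0 (n : ℤ) : (s12 * s23) ^ n * s12 ∈ Set.range phi0 := by
  obtain ⟨m, rfl | rfl | rfl⟩ : ∃ m, n = 3 * m ∨ n = 3 * m + 1 ∨ n = 3 * m - 1 :=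
    ⟨(n + 1) / 3, by omega⟩
  · refine ⟨(.v213, 2 * m), ?_⟩
    rw [phi0, if_pos (by omega)]
    congr 2; omega
  · refine ⟨(.v123, 2 * m + 1), ?_⟩
    rw [phi0, if_neg (by omega)]
    congr 2; omega
  · refine ⟨(.v132, 2 * m), ?_⟩
    rw [phi0, if_pos (by omega)]
    congr 2; omega

theorem phi0_mem_H (p : L × ℤ) : phi0 p ∈ H := by
  have h12 : s12 ∈ H := Subgroup.subset_closure (by simp)
  have h23 : s23 ∈ H := Subgroup.subset_closure (by simp)
  have hr (n : ℤ) : (s12 * s23) ^ n ∈ H := H.zpow_mem (H.mul_mem h12 h23) n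
  obtain ⟨a, k⟩ := p
  cases a <;> rw [phi0] <;> split_ifs <;>
    first
    | exact hr _
    | exact H.mul_mem (hr _) h12

/-- the range of `φ₀` is exactly the subgroup `H`. -/
theorem phi0_range : Set.range phi0 = (H : Set J3) := by
  refine Set.Subset.antisymm (Set.range_subset_iff.2 phi0_mem_H) fun x hx => ?_
  obtain ⟨n, rfl | rfl⟩ := exists_zpow_of_mem_closure_pair s12_mul_self s23_mul_self hx
  · exact zpow_mem_range_phi0 n
  · exact zpow_mul_s12_mem_range_phi0 n
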